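/- (Asymptotic behavioral improvement: concluding remark of Section 4.1.) Let M be an MDP with rewards in [−Rmax, Rmax] and discount γ ∈ [0,1), and let M̂_p be the (α, Rmax)-pessimistic MDP built from an approximate kernel P̂, its α-unknown set U, and estimated initial distribution ρ̂0. Suppose (i) D_TV(ρ0, ρ̂0) = 0, (ii) α = 0, (iii) the behavior policy π_b never visits U when executed in M from ρ0, i.e., T_U^{π_b} = ∞ almost surely, and (iv) π_out is an optimal policy for M̂_p (ε_π = 0). Then J_{ρ0}(π_out, M) ≥ J_{ρ0}(π_b, M). -/

import Mathlib

open scoped ENNReal NNReal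
open Classical

namespace MOReL

universe u v

variable {S : Type u} {A : Type v}

/-- Distribution over trajectory prefixes `(s_0,a_0),…,(s_n,a_n)` generated by executing
policy `π` in the MDP with transition kernel `P` starting from `ρ0`. -/
noncomputable def pathPMF (ρ0 : PMF S) (π : S → PMF A) (P : S → A → PMF S) :
    (n : ℕ) → PMF (Fin (n + 1) → S × A)
  | 0 => ρ0.bind fun s => (π s).map fun a => fun _ => (s, a)
  | n + 1 =>
      (pathPMF ρ0 π P n).bind fun p =>
        (P (p (Fin.last n)).1 (p (Fin.last n)).2).bind fun s' =>
          (π s').map fun a' => Fin.snoc p (s', a')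

/-- Marginal distribution of `(s_t, a_t)`. -/
noncomputable def saDist (ρ0 : PMF S) (π : S → PMF A) (P : S → A → PMF S) (t : ℕ) :
    PMF (S × A) :=
  (pathPMF ρ0 π P t).map fun p => p (Fin.last t)

/-- Expectation of a real-valued function under a PMF. -/
noncomputable def pexp {α : Type*} (μ : PMF α) (f : α → ℝ) : ℝ :=
  ∑' x, (μ x).toReal * f x

/-- The value `J_{ρ0}(π, M) = E[∑_t γ^t r(s_t,a_t)]`. -/
noncomputable def J (ρ0 : PMF S) (π : S → PMF A) (P : S → A → PMF S) (γ : ℝ)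
    (r : S → A → ℝ) : ℝ :=
  ∑' t : ℕ, γ ^ t * pexp (saDist ρ0 π P t) (fun sa => r sa.1 sa.2)

/-- `P(T_V^π = t)`: the probability that the first visit of the executed trajectory to the
state-action set `V` occurs at time `t`. -/
noncomputable def hitProb (ρ0 : PMF S) (π : S → PMF A) (P : S → A → PMF S)
    (V : Set (S × A)) (t : ℕ) : ℝ≥0∞ :=
  (pathPMF ρ0 π P t).toOuterMeasure
    {p | p (Fin.last t) ∈ V ∧ ∀ i : Fin (t + 1), (i : ℕ) < t → p i ∉ V}

/-- `E[γ^{T_V^π}]`, with the convention `γ^∞ = 0`. -/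
noncomputable def discHit (ρ0 : PMF S) (π : S → PMF A) (P : S → A → PMF S) (γ : ℝ)
    (V : Set (S × A)) : ℝ :=
  ∑' t : ℕ, γ ^ t * (hitProb ρ0 π P V t).toReal

/-- Total variation distance between two PMFs. -/
noncomputable def DTV {α : Type*} (p q : PMF α) : ℝ :=
  (1 / 2) * ∑' x, |(p x).toReal - (q x).toReal|

/-- Discounted state-action visitation distribution `d^{π,M}(s,a)`. -/
noncomputable def dVisit (ρ0 : PMF S) (π : S → PMF A) (P : S → A → PMF S) (γ : ℝ)
    (sa : S × A) : ℝ :=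
  (1 - γ) * ∑' t : ℕ, γ ^ t * ((saDist ρ0 π P t) sa).toReal

/-- `d^{π,M}(V)` for a set `V` of state-action pairs. -/
noncomputable def dVisitSet (ρ0 : PMF S) (π : S → PMF A) (P : S → A → PMF S) (γ : ℝ)
    (V : Set (S × A)) : ℝ :=
  ∑' sa : V, dVisit ρ0 π P γ sa

/-- The set of `α`-unknown state-action pairs. -/
def unknown (P Phat : S → A → PMF S) (α : ℝ) : Set (S × A) :=
  {sa | α < DTV (Phat sa.1 sa.2) (P sa.1 sa.2)}

/-- Transition kernel of the pessimistic MDP on `Option S` (`none` is the absorbing state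
HALT): unknown pairs and HALT transition to HALT, known pairs follow `Phat`. -/
noncomputable def pessKernel (Phat : S → A → PMF S) (U : Set (S × A)) :
    Option S → A → PMF (Option S) := fun s a =>
  match s with
  | none => PMF.pure none
  | some s => if (s, a) ∈ U then PMF.pure none else (Phat s a).map some

/-- Reward of the pessimistic MDP: `-κ` at HALT and `r` elsewhere. -/
def pessReward (r : S → A → ℝ) (κ : ℝ) : Option S → A → ℝ := fun s a =>
  match s with
  | none => -κ
  | some s => r s a

/-- Extend a policy on `S` to `Option S` by an arbitrary action distribution at HALT
(the pessimistic value does not depend on this choice). -/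
def extendPolicy (π : S → PMF A) (a0 : PMF A) : Option S → PMF A := fun s =>
  match s with
  | none => a0
  | some s => π s

end MOReL

namespace MOReL

theorem saDist_zero (ρ0 : PMF S) (π : S → PMF A) (P : S → A → PMF S) :
    saDist ρ0 π P 0 = ρ0.bind fun s => (π s).map (Prod.mk s) := by
  simp only [saDist, pathPMF, PMF.map_bind, PMF.map_comp]
  rfl

theorem saDist_succ (ρ0 : PMF S) (π : S → PMF A) (P : S → A → PMF S) (t : ℕ) :
    saDist ρ0 π P (t + 1) = (saDist ρ0 π P t).bind fun sa =>
      (P sa.1 sa.2).bind fun s' => (π s').map (Prod.mk s') := by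
  simp only [saDist, pathPMF, PMF.map_bind, PMF.map_comp, PMF.bind_map, Function.comp_def,
    Fin.snoc_last]

section PMFLemmas

variable {α β α' β' : Type*}

theorem summable_toReal (p : PMF α) : Summable fun x => (p x).toReal :=
  ENNReal.summable_toReal p.tsum_coe_ne_top

theorem tsum_toReal (p : PMF α) : ∑' x, (p x).toReal = 1 := by
  rw [← ENNReal.tsum_toReal_eq p.apply_ne_top, p.tsum_coe, ENNReal.toReal_one]

theorem DTV_nonneg (p q : PMF α) : 0 ≤ DTV p q :=
  mul_nonneg (by norm_num) (tsum_nonneg fun _ => abs_nonneg _)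

theorem eq_of_DTV_eq_zero {p q : PMF α} (h : DTV p q = 0) : p = q := by
  have hs : Summable fun x => |(p x).toReal - (q x).toReal| :=
    ((summable_toReal p).sub (summable_toReal q)).abs
  have h0 : ∑' x, |(p x).toReal - (q x).toReal| = 0 := by
    unfold DTV at h
    linarith
  have hz := (hasSum_zero_iff_of_nonneg fun x => abs_nonneg _).1 (h0 ▸ hs.hasSum)
  ext x
  have hx : |(p x).toReal - (q x).toReal| = 0 := congrFun hz x
  exact (ENNReal.toReal_eq_toReal_iff' (p.apply_ne_top x) (q.apply_ne_top x)).1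
    (sub_eq_zero.1 (abs_eq_zero.1 hx))

theorem map_apply_of_injective (p : PMF α) {g : α → β} (hg : g.Injective) (x : α) :
    p.map g (g x) = p x := by
  rw [PMF.map_apply, tsum_eq_single x fun y hy => if_neg fun h => hy (hg h).symm, if_pos rfl]

theorem map_apply_of_notMem_range (p : PMF α) {g : α → β} {y : β} (hy : y ∉ Set.range g) :
    p.map g y = 0 := by
  rw [PMF.apply_eq_zero_iff, PMF.support_map]
  exact fun h => hy (Set.image_subset_range _ _ h)

theorem bind_congr_support (p : PMF α) {k l : α → PMF β} (h : ∀ x ∈ p.support, k x = l x) :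
    p.bind k = p.bind l := by
  ext y
  rw [PMF.bind_apply, PMF.bind_apply]
  refine tsum_congr fun x => ?_
  by_cases hx : x ∈ p.support
  · rw [h x hx]
  · rw [(p.apply_eq_zero_iff x).2 hx, zero_mul, zero_mul]

/-- Domination of PMFs along an injection is preserved by dominated kernels. -/
theorem bind_apply_le_bind_apply {p : PMF β} {q : PMF α} {g : α → β} (hg : g.Injective)
    (hpq : ∀ x, p (g x) ≤ q x) {k : β → PMF β'} {l : α → PMF α'} {z : β'} {y : α'}
    (hk : ∀ b ∉ Set.range g, k b z = 0) (hkl : ∀ x, k (g x) z ≤ l x y) :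
    p.bind k z ≤ q.bind l y := by
  rw [PMF.bind_apply, PMF.bind_apply, ← hg.tsum_eq (f := fun b => p b * k b z)]
  · exact ENNReal.tsum_le_tsum fun x => mul_le_mul' (hpq x) (hkl x)
  · intro b hb
    by_contra h
    exact hb (by simp [hk b h])

theorem summable_toReal_mul (p : PMF α) {f : α → ℝ} {C : ℝ} (hf : ∀ x, |f x| ≤ C) :
    Summable fun x => (p x).toReal * f x := by
  refine Summable.of_norm_bounded ((summable_toReal p).mul_right C) fun x => ?_
  rw [Real.norm_eq_abs, abs_mul, abs_of_nonneg ENNReal.toReal_nonneg]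
  exact mul_le_mul_of_nonneg_left (hf x) ENNReal.toReal_nonneg

theorem pexp_add_const (p : PMF α) {f : α → ℝ} {C : ℝ} (hf : ∀ x, |f x| ≤ C) (c : ℝ) :
    pexp p (fun x => f x + c) = pexp p f + c := by
  simp only [pexp, mul_add]
  rw [(summable_toReal_mul p hf).tsum_add ((summable_toReal p).mul_right c), tsum_mul_right,
    tsum_toReal, one_mul]

theorem abs_pexp_le (p : PMF α) {f : α → ℝ} {C : ℝ} (hf : ∀ x, |f x| ≤ C) :
    |pexp p f| ≤ C := by
  have h := tsum_of_norm_bounded ((summable_toReal p).mul_right C).hasSum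
    (f := fun x => (p x).toReal * f x) fun x => by
      rw [Real.norm_eq_abs, abs_mul, abs_of_nonneg ENNReal.toReal_nonneg]
      exact mul_le_mul_of_nonneg_left (hf x) ENNReal.toReal_nonneg
  rwa [tsum_mul_right, tsum_toReal, one_mul] at h

theorem pexp_map_of_injective (p : PMF α) {g : α → β} (hg : g.Injective) (f : β → ℝ) :
    pexp (p.map g) f = pexp p (f ∘ g) := by
  unfold pexp
  rw [← hg.tsum_eq (f := fun b => (p.map g b).toReal * f b)]
  · simp only [map_apply_of_injective p hg, Function.comp_apply]
  · intro b hb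
    by_contra h
    exact hb (by simp [map_apply_of_notMem_range p h])

/-- If `p` is dominated by `q` along an injection outside whose range `f` takes its
lower bound `-C`, then the `p`-expectation of `f` is at most its `q`-expectation. -/
theorem pexp_le_pexp_comp {p : PMF β} {q : PMF α} {g : α → β} (hg : g.Injective)
    (hpq : ∀ x, p (g x) ≤ q x) {f : β → ℝ} {C : ℝ} (hf : ∀ b, |f b| ≤ C)
    (hfg : ∀ b ∉ Set.range g, f b = -C) : pexp p f ≤ pexp q (f ∘ g) := by
  have hbound : ∀ b, |f b + C| ≤ C + C := fun b => by
    have := abs_le.1 (hf b)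
    exact abs_le.2 ⟨by linarith, by linarith⟩
  have key : pexp p (fun b => f b + C) ≤ pexp q (fun x => (f ∘ g) x + C) := by
    unfold pexp
    rw [← hg.tsum_eq (f := fun b => (p b).toReal * (f b + C))]
    · refine ((summable_toReal_mul p hbound).comp_injective hg).tsum_le_tsum (fun x => ?_)
        (summable_toReal_mul q fun x => hbound (g x))
      exact mul_le_mul_of_nonneg_right
        (ENNReal.toReal_mono (q.apply_ne_top x) (hpq x)) (by linarith [(abs_le.1 (hf (g x))).1])
    · intro b hb
      by_contra h
      exact hb (by simp [hfg b h])
  rw [pexp_add_const p hf, pexp_add_const q (f := f ∘ g) fun x => hf (g x)] at key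
  linarith

end PMFLemmas

theorem summable_discounted {u : ℕ → ℝ} {γ C : ℝ} (hγ0 : 0 ≤ γ) (hγ1 : γ < 1)
    (hu : ∀ t, |u t| ≤ C) : Summable fun t => γ ^ t * u t := by
  refine Summable.of_norm_bounded ((summable_geometric_of_lt_one hγ0 hγ1).mul_right C)
    fun t => ?_
  rw [Real.norm_eq_abs, abs_mul, abs_of_nonneg (pow_nonneg hγ0 t)]
  exact mul_le_mul_of_nonneg_left (hu t) (pow_nonneg hγ0 t)

/-- Inclusion of the state-action pairs of an MDP into those of its pessimistic version. -/
def embed (sa : S × A) : Option S × A := (some sa.1, sa.2)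

theorem embed_injective : (embed : S × A → Option S × A).Injective := by
  rintro ⟨s, a⟩ ⟨s', a'⟩ h
  simpa [embed] using h

theorem notMem_range_embed {b : Option S × A} (hb : b ∉ Set.range embed) : b.1 = none := by
  obtain ⟨_ | s, a⟩ := b
  · rfl
  · exact absurd ⟨(s, a), rfl⟩ hb

theorem Phat_eq_of_notMem_unknown {P Phat : S → A → PMF S} {sa : S × A}
    (h : sa ∉ unknown P Phat 0) : Phat sa.1 sa.2 = P sa.1 sa.2 :=
  eq_of_DTV_eq_zero (le_antisymm (not_lt.1 h) (DTV_nonneg _ _))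

theorem pessKernel_of_known {P Phat : S → A → PMF S} {sa : S × A}
    (h : sa ∉ unknown P Phat 0) :
    pessKernel Phat (unknown P Phat 0) (some sa.1) sa.2 = (P sa.1 sa.2).map some := by
  rw [← Phat_eq_of_notMem_unknown h]
  exact if_neg h

theorem pessKernel_some_le (P Phat : S → A → PMF S) (sa : S × A) (s : S) :
    pessKernel Phat (unknown P Phat 0) (some sa.1) sa.2 (some s) ≤ P sa.1 sa.2 s := by
  by_cases h : sa ∈ unknown P Phat 0
  · have : pessKernel Phat (unknown P Phat 0) (some sa.1) sa.2 = PMF.pure none := if_pos h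
    simp [this]
  · rw [pessKernel_of_known h, map_apply_of_injective _ (Option.some_injective S)]

theorem bind_policy_apply_embed_le {p : PMF (Option S)} {q : PMF S}
    (h : ∀ s, p (some s) ≤ q s) (π : Option S → PMF A) (sa : S × A) :
    (p.bind fun s => (π s).map (Prod.mk s)) (embed sa)
      ≤ (q.bind fun s => (π (some s)).map (Prod.mk s)) sa := by
  refine bind_apply_le_bind_apply (Option.some_injective S) h (fun b hb => ?_) fun s => ?_
  · refine map_apply_of_notMem_range _ ?_
    rintro ⟨a, ha⟩
    exact hb ⟨sa.1, (congrArg Prod.fst ha).symm⟩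
  · obtain ⟨s', a⟩ := sa
    by_cases hs : s = s'
    · subst hs
      exact (map_apply_of_injective _ (Prod.mk_right_injective (some s)) a).trans_le
        (map_apply_of_injective _ (Prod.mk_right_injective s) a).ge
    · rw [map_apply_of_notMem_range]
      · exact zero_le
      · rintro ⟨a', ha⟩
        exact hs (Option.some_injective S (congrArg Prod.fst ha))

/-- Away from HALT, occupation probabilities in the pessimistic MDP are at most those in the
true MDP. -/
theorem saDist_pess_embed_le (P Phat : S → A → PMF S) (ρ0 : PMF S) (π : Option S → PMF A)
    (t : ℕ) (sa : S × A) :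
    saDist (ρ0.map some) π (pessKernel Phat (unknown P Phat 0)) t (embed sa)
      ≤ saDist ρ0 (fun s => π (some s)) P t sa := by
  induction t generalizing sa with
  | zero =>
    rw [saDist_zero, saDist_zero]
    exact bind_policy_apply_embed_le
      (fun s => (map_apply_of_injective _ (Option.some_injective S) s).le) π sa
  | succ t ih =>
    rw [saDist_succ, saDist_succ]
    refine bind_apply_le_bind_apply embed_injective ih (fun b hb => ?_) fun x =>
      bind_policy_apply_embed_le (pessKernel_some_le P Phat x) π sa
    obtain ⟨o, a⟩ := b
    obtain rfl : o = none := notMem_range_embed hb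
    simp only [pessKernel, PMF.pure_bind]
    refine map_apply_of_notMem_range _ ?_
    rintro ⟨a', ha⟩
    exact absurd (congrArg Prod.fst ha) (by simp [embed])

theorem map_embed_bind_policy (q : PMF S) (π : S → PMF A) (a0 : PMF A) :
    ((q.map some).bind fun s => (extendPolicy π a0 s).map (Prod.mk s))
      = (q.bind fun s => (π s).map (Prod.mk s)).map embed := by
  simp only [PMF.bind_map, PMF.map_bind, PMF.map_comp]
  rfl

/-- A policy that never visits the unknown set has the same occupation probabilities in the
pessimistic MDP as in the true one. -/
theorem saDist_pess_extendPolicy {P Phat : S → A → PMF S} {ρ0 : PMF S} {π : S → PMF A}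
    (hvisit : ∀ t, (saDist ρ0 π P t).toOuterMeasure (unknown P Phat 0) = 0) (a0 : PMF A)
    (t : ℕ) :
    saDist (ρ0.map some) (extendPolicy π a0) (pessKernel Phat (unknown P Phat 0)) t
      = (saDist ρ0 π P t).map embed := by
  induction t with
  | zero => rw [saDist_zero, saDist_zero, map_embed_bind_policy]
  | succ t ih =>
    rw [saDist_succ, saDist_succ, ih, PMF.bind_map, PMF.map_bind]
    refine bind_congr_support _ fun sa hsa => ?_
    have hknown : sa ∉ unknown P Phat 0 :=
      Set.disjoint_left.1 ((PMF.toOuterMeasure_apply_eq_zero_iff _ _).1 (hvisit t)) hsa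
    rw [← map_embed_bind_policy, ← pessKernel_of_known hknown]
    rfl

/-- **Asymptotic behavioral improvement** (concluding remark of Section 4.1): if the initial
distribution is estimated exactly, the model is exact on known pairs (`α = 0`), the
behavior policy almost surely never visits the unknown set, and `πout` is optimal for the
pessimistic MDP, then `πout` is at least as good as the behavior policy in the true MDP. -/
theorem asymptotic_behavior_improvement
    {S : Type u} {A : Type v} [Countable S] [Countable A]
    (P Phat : S → A → PMF S) (ρ0 ρhat : PMF S)
    (r : S → A → ℝ) (Rmax : ℝ) (hR : ∀ s a, |r s a| ≤ Rmax)
    (γ : ℝ) (hγ0 : 0 ≤ γ) (hγ1 : γ < 1)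
    (πb : S → PMF A)
    (hρ : DTV ρ0 ρhat = 0)
    (hvisit : ∀ t : ℕ,
      (saDist ρ0 πb P t).toOuterMeasure (unknown P Phat 0) = 0)
    (πout : Option S → PMF A)
    (hopt : ∀ πe : Option S → PMF A,
      J (ρhat.map some) πe (pessKernel Phat (unknown P Phat 0)) γ (pessReward r Rmax)
        ≤ J (ρhat.map some) πout (pessKernel Phat (unknown P Phat 0)) γ
            (pessReward r Rmax)) :
    J ρ0 πb P γ r ≤ J ρ0 (fun s => πout (some s)) P γ r := by
  obtain rfl : ρ0 = ρhat := eq_of_DTV_eq_zero hρ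
  obtain ⟨a, -⟩ := (πout none).support_nonempty
  obtain ⟨s, -⟩ := ρ0.support_nonempty
  have hR0 : 0 ≤ Rmax := (abs_nonneg _).trans (hR s a)
  have hpess : ∀ b : Option S × A, |pessReward r Rmax b.1 b.2| ≤ Rmax := by
    rintro ⟨_ | s, a⟩
    · exact (abs_neg Rmax).trans_le (abs_of_nonneg hR0).le
    · exact hR s a
  calc J ρ0 πb P γ r
      = J (ρ0.map some) (extendPolicy πb (πout none)) (pessKernel Phat (unknown P Phat 0)) γ
          (pessReward r Rmax) := by
        unfold J
        refine tsum_congr fun t => ?_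
        rw [saDist_pess_extendPolicy hvisit, pexp_map_of_injective _ embed_injective]
        rfl
    _ ≤ J (ρ0.map some) πout (pessKernel Phat (unknown P Phat 0)) γ (pessReward r Rmax) :=
        hopt _
    _ ≤ J ρ0 (fun s => πout (some s)) P γ r := by
        refine (summable_discounted hγ0 hγ1 fun t => abs_pexp_le _ hpess).tsum_le_tsum
          (fun t => mul_le_mul_of_nonneg_left ?_ (pow_nonneg hγ0 t))
          (summable_discounted hγ0 hγ1 fun t => abs_pexp_le _ fun sa => hR sa.1 sa.2)
        refine pexp_le_pexp_comp embed_injective (saDist_pess_embed_le P Phat ρ0 πout t) hpess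
          fun b hb => ?_
        rw [notMem_range_embed hb]
        rfl

end MOReL
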